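/- Finite-horizon Bellman optimality for partially observed models: the maximum of the expected discounted return over all history-dependent policies equals the optimal history value at the empty history, max over all policies π of J(π) = V*_0(empty history); moreover, the maximum is attained by any policy that at every reachable history o ∈ O_t selects an action in argmax_{u∈U} Q*_t(o,u). -/

import Mathlib

open scoped Classical

namespace DecPOMDP

variable {X U Z : Type}

/-- Auxiliary filter, recursing on the (reversed) history. -/
noncomputable def filtAux [Fintype X] (s0 : X → ℝ) (p : X → U → X → Z → ℝ) :
    List (U × Z) → X → ℝ
  | [], x => s0 x
  | uz :: rest, y => ∑ x, filtAux s0 p rest x * p x uz.1 y uz.2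

/-- The policy-independent unnormalized filter `μ`:
`filt s0 p [] = s0` and `filt s0 p (o ++ [(u,z)]) y = ∑ x, filt s0 p o x * p x u y z`. -/
noncomputable def filt [Fintype X] (s0 : X → ℝ) (p : X → U → X → Z → ℝ)
    (o : List (U × Z)) (x : X) : ℝ :=
  filtAux s0 p o.reverse x

/-- A history is reachable if its total filter mass is positive. -/
def reachable [Fintype X] (s0 : X → ℝ) (p : X → U → X → Z → ℝ)
    (o : List (U × Z)) : Prop :=
  0 < ∑ x, filt s0 p o x

/-- The belief (normalized filter) of a history. -/
noncomputable def bel [Fintype X] (s0 : X → ℝ) (p : X → U → X → Z → ℝ)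
    (o : List (U × Z)) (x : X) : ℝ :=
  filt s0 p o x / ∑ x', filt s0 p o x'

/-- Optimal history value with `k` stages to go: `Vstar s0 p r γ (ℓ - t)` is `V*_t`. -/
noncomputable def Vstar [Fintype X] [Fintype U] [Fintype Z] [Nonempty U]
    (s0 : X → ℝ) (p : X → U → X → Z → ℝ) (r : X → U → ℝ) (γ : ℝ) :
    ℕ → List (U × Z) → ℝ
  | 0, _ => 0
  | k + 1, o =>
    Finset.univ.sup' Finset.univ_nonempty fun u : U =>
      (∑ x, bel s0 p o x * r x u) +
        γ * ∑ z : Z,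
          if reachable s0 p (o ++ [(u, z)]) then
            (∑ x, ∑ y, bel s0 p o x * p x u y z) * Vstar s0 p r γ k (o ++ [(u, z)])
          else 0

/-- Optimal history action-value: `Qstar s0 p r γ (ℓ - t - 1)` is `Q*_t` (for `t < ℓ`). -/
noncomputable def Qstar [Fintype X] [Fintype U] [Fintype Z] [Nonempty U]
    (s0 : X → ℝ) (p : X → U → X → Z → ℝ) (r : X → U → ℝ) (γ : ℝ)
    (k : ℕ) (o : List (U × Z)) (u : U) : ℝ :=
  (∑ x, bel s0 p o x * r x u) +
    γ * ∑ z : Z,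
      if reachable s0 p (o ++ [(u, z)]) then
        (∑ x, ∑ y, bel s0 p o x * p x u y z) * Vstar s0 p r γ k (o ++ [(u, z)])
      else 0

/-- The history generated up to stage `t` by policy `π` along observation stream `z`
(`z t` being the observation received at stage `t+1`). -/
def hist (π : List (U × Z) → U) (z : ℕ → Z) : ℕ → List (U × Z)
  | 0 => []
  | t + 1 => hist π z t ++ [(π (hist π z t), z t)]

/-- Extend a finitely indexed stream to `ℕ` (junk beyond `m`). -/
noncomputable def extend {α : Type} [Nonempty α] (m : ℕ) (f : Fin m → α) (t : ℕ) : α :=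
  if h : t < m then f ⟨t, h⟩ else Classical.arbitrary α

/-- Expected discounted return `J(π)`: a finite sum over trajectories
`(x_0, …, x_ℓ, z_1, …, z_ℓ)` of the trajectory probability times the discounted return,
actions being chosen by `π` on the generated histories. -/
noncomputable def Jret [Fintype X] [Fintype U] [Fintype Z] [Nonempty X] [Nonempty Z]
    (s0 : X → ℝ) (p : X → U → X → Z → ℝ) (r : X → U → ℝ) (γ : ℝ) (ℓ : ℕ)
    (π : List (U × Z) → U) : ℝ :=
  ∑ x : Fin (ℓ + 1) → X, ∑ z : Fin ℓ → Z,
    (s0 (extend (ℓ + 1) x 0) *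
        ∏ t ∈ Finset.range ℓ,
          p (extend (ℓ + 1) x t) (π (hist π (extend ℓ z) t))
            (extend (ℓ + 1) x (t + 1)) (extend ℓ z t)) *
      ∑ t ∈ Finset.range ℓ, γ ^ t * r (extend (ℓ + 1) x t) (π (hist π (extend ℓ z) t))

/-- `Pr_π(o_t = o ∧ x_t = xh)`: a finite sum over partial trajectories. -/
noncomputable def PrHS [Fintype X] [Fintype U] [Fintype Z] [Nonempty X] [Nonempty Z]
    (s0 : X → ℝ) (p : X → U → X → Z → ℝ) (π : List (U × Z) → U)
    (t : ℕ) (o : List (U × Z)) (xh : X) : ℝ :=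
  ∑ x : Fin (t + 1) → X, ∑ z : Fin t → Z,
    if hist π (extend t z) t = o ∧ extend (t + 1) x t = xh then
      s0 (extend (t + 1) x 0) *
        ∏ s ∈ Finset.range t,
          p (extend (t + 1) x s) (π (hist π (extend t z) s))
            (extend (t + 1) x (s + 1)) (extend t z s)
    else 0

/-- `Pr_π(o_t = o)`. -/
noncomputable def PrH [Fintype X] [Fintype U] [Fintype Z] [Nonempty X] [Nonempty Z]
    (s0 : X → ℝ) (p : X → U → X → Z → ℝ) (π : List (U × Z) → U)
    (t : ℕ) (o : List (U × Z)) : ℝ :=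
  ∑ xh, PrHS s0 p π t o xh

end DecPOMDP

namespace DecPOMDP

section Bellman

variable {X U Z : Type}

/-- Prepend an element to a stream. -/
def consStream {α : Type} (a : α) (s : ℕ → α) : ℕ → α
  | 0 => a
  | t + 1 => s t

/-- The history generated by `π` along `z`, starting from the history `o`. -/
def histFrom (π : List (U × Z) → U) (o : List (U × Z)) (z : ℕ → Z) : ℕ → List (U × Z)
  | 0 => o
  | t + 1 => histFrom π o z t ++ [(π (histFrom π o z t), z t)]

theorem histFrom_zero (π : List (U × Z) → U) (o : List (U × Z)) (z : ℕ → Z) :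
    histFrom π o z 0 = o := rfl

theorem hist_eq_histFrom (π : List (U × Z) → U) (z : ℕ → Z) (t : ℕ) :
    hist π z t = histFrom π [] z t := by
  induction t with
  | zero => rfl
  | succ t ih => simp only [hist, histFrom, ih]

theorem consStream_zero {α : Type} (a : α) (s : ℕ → α) : consStream a s 0 = a := rfl

theorem consStream_succ {α : Type} (a : α) (s : ℕ → α) (t : ℕ) :
    consStream a s (t + 1) = s t := rfl

theorem histFrom_consStream_succ (π : List (U × Z) → U) (o : List (U × Z)) (b : Z)
    (z : ℕ → Z) (t : ℕ) :
    histFrom π o (consStream b z) (t + 1) = histFrom π (o ++ [(π o, b)]) z t := by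
  induction t with
  | zero => rfl
  | succ t ih => rw [histFrom, ih, histFrom, consStream]

theorem extend_cons {α : Type} [Nonempty α] (m : ℕ) (a : α) (f : Fin m → α) :
    extend (m + 1) (Fin.cons a f : Fin (m + 1) → α) = consStream a (extend m f) := by
  funext t
  cases t with
  | zero => simp [extend, consStream]
  | succ t =>
    by_cases h : t < m
    · rw [extend, dif_pos (Nat.succ_lt_succ h), consStream, extend, dif_pos h]
      rfl
    · simp [extend, consStream, h]

theorem sum_fin_cons {α : Type} [Fintype α] (m : ℕ) (F : (Fin (m + 1) → α) → ℝ) :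
    ∑ f, F f = ∑ a : α, ∑ f : Fin m → α, F (Fin.cons a f) := by
  rw [← (Fin.consEquiv fun _ : Fin (m + 1) => α).sum_comp, Fintype.sum_prod_type]
  rfl

/-- Expected discounted return of `π` over `k` stages from hidden state `x` and history `o`. -/
noncomputable def condReturn [Fintype X] [Fintype Z] (p : X → U → X → Z → ℝ)
    (r : X → U → ℝ) (γ : ℝ) (π : List (U × Z) → U) : ℕ → List (U × Z) → X → ℝ
  | 0, _, _ => 0
  | k + 1, o, x =>
    r x (π o) + γ * ∑ y, ∑ z, p x (π o) y z * condReturn p r γ π k (o ++ [(π o, z)]) y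

theorem sum_trajectories_eq_condReturn [Fintype X] [Nonempty X] [Fintype Z] [Nonempty Z]
    (p : X → U → X → Z → ℝ) (hpsum : ∀ x u, ∑ y, ∑ z, p x u y z = 1)
    (r : X → U → ℝ) (γ : ℝ) (π : List (U × Z) → U) (k : ℕ) (o : List (U × Z)) (a : X)
    (c d : ℝ) :
    ∑ x : Fin k → X, ∑ z : Fin k → Z,
      (∏ t ∈ Finset.range k, p (consStream a (extend k x) t) (π (histFrom π o (extend k z) t))
          (extend k x t) (extend k z t)) *
        (c + d * ∑ t ∈ Finset.range k,
          γ ^ t * r (consStream a (extend k x) t) (π (histFrom π o (extend k z) t))) =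
      c + d * condReturn p r γ π k o a := by
  induction k generalizing o a c d with
  | zero => simp [condReturn]
  | succ k ih =>
    have step : ∀ (y : X) (x : Fin k → X) (b : Z) (z : Fin k → Z),
        (∏ t ∈ Finset.range (k + 1),
            p (consStream a (extend (k + 1) (Fin.cons y x : Fin (k + 1) → X)) t)
              (π (histFrom π o (extend (k + 1) (Fin.cons b z : Fin (k + 1) → Z)) t))
              (extend (k + 1) (Fin.cons y x : Fin (k + 1) → X) t)
              (extend (k + 1) (Fin.cons b z : Fin (k + 1) → Z) t)) *
          (c + d * ∑ t ∈ Finset.range (k + 1),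
            γ ^ t * r (consStream a (extend (k + 1) (Fin.cons y x : Fin (k + 1) → X)) t)
              (π (histFrom π o (extend (k + 1) (Fin.cons b z : Fin (k + 1) → Z)) t))) =
        p a (π o) y b *
          ((∏ t ∈ Finset.range k, p (consStream y (extend k x) t)
              (π (histFrom π (o ++ [(π o, b)]) (extend k z) t)) (extend k x t) (extend k z t)) *
            ((c + d * r a (π o)) + (d * γ) * ∑ t ∈ Finset.range k,
              γ ^ t * r (consStream y (extend k x) t)
                (π (histFrom π (o ++ [(π o, b)]) (extend k z) t)))) := by
      intro y x b z
      simp only [extend_cons, Finset.prod_range_succ', Finset.sum_range_succ',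
        histFrom_consStream_succ, consStream_succ, consStream_zero, histFrom_zero, pow_succ',
        pow_zero, one_mul, mul_assoc γ, ← Finset.mul_sum]
      ring
    simp only [sum_fin_cons k, step]
    have inner : ∀ y : X,
        (∑ x : Fin k → X, ∑ b : Z, ∑ z : Fin k → Z, p a (π o) y b *
          ((∏ t ∈ Finset.range k, p (consStream y (extend k x) t)
              (π (histFrom π (o ++ [(π o, b)]) (extend k z) t)) (extend k x t) (extend k z t)) *
            ((c + d * r a (π o)) + (d * γ) * ∑ t ∈ Finset.range k,
              γ ^ t * r (consStream y (extend k x) t)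
                (π (histFrom π (o ++ [(π o, b)]) (extend k z) t))))) =
        ∑ b : Z, p a (π o) y b * ((c + d * r a (π o)) +
          (d * γ) * condReturn p r γ π k (o ++ [(π o, b)]) y) := by
      intro y
      rw [Finset.sum_comm]
      refine Finset.sum_congr rfl fun b _ => ?_
      rw [← ih, Finset.mul_sum]
      exact Finset.sum_congr rfl fun x _ => (Finset.mul_sum _ _ _).symm
    simp only [inner, condReturn]
    simp only [mul_add, Finset.sum_add_distrib, ← Finset.sum_mul, hpsum, Finset.mul_sum]
    simp only [one_mul, mul_assoc, mul_left_comm, add_assoc]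

theorem Jret_eq_sum_condReturn [Fintype X] [Nonempty X] [Fintype U] [Fintype Z] [Nonempty Z]
    (s0 : X → ℝ) (p : X → U → X → Z → ℝ) (hpsum : ∀ x u, ∑ y, ∑ z, p x u y z = 1)
    (r : X → U → ℝ) (γ : ℝ) (ℓ : ℕ) (π : List (U × Z) → U) :
    Jret s0 p r γ ℓ π = ∑ a, s0 a * condReturn p r γ π ℓ [] a := by
  rw [Jret, sum_fin_cons]
  refine Finset.sum_congr rfl fun a _ => ?_
  have h := sum_trajectories_eq_condReturn p hpsum r γ π ℓ [] a 0 1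
  simp only [zero_add, one_mul] at h
  rw [← h, Finset.mul_sum]
  refine Finset.sum_congr rfl fun x _ => ?_
  rw [Finset.mul_sum]
  refine Finset.sum_congr rfl fun z _ => ?_
  simp only [extend_cons, consStream_zero, consStream_succ, hist_eq_histFrom, mul_assoc]

theorem filt_append [Fintype X] (s0 : X → ℝ) (p : X → U → X → Z → ℝ) (o : List (U × Z))
    (u : U) (z : Z) (y : X) :
    filt s0 p (o ++ [(u, z)]) y = ∑ x, filt s0 p o x * p x u y z := by
  simp [filt, filtAux]

theorem filt_nonneg [Fintype X] {s0 : X → ℝ} (hs0 : ∀ x, 0 ≤ s0 x) {p : X → U → X → Z → ℝ}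
    (hp : ∀ x u y z, 0 ≤ p x u y z) (o : List (U × Z)) (x : X) : 0 ≤ filt s0 p o x := by
  induction o using List.reverseRecOn generalizing x with
  | nil => exact hs0 x
  | append_singleton o uz ih =>
    rw [filt_append]
    exact Finset.sum_nonneg fun x' _ => mul_nonneg (ih x') (hp _ _ _ _)

theorem mass_mul_bel [Fintype X] {s0 : X → ℝ} (hs0 : ∀ x, 0 ≤ s0 x) {p : X → U → X → Z → ℝ}
    (hp : ∀ x u y z, 0 ≤ p x u y z) (o : List (U × Z)) (x : X) :
    (∑ x', filt s0 p o x') * bel s0 p o x = filt s0 p o x := by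
  by_cases h : ∑ x', filt s0 p o x' = 0
  · rw [h, zero_mul, (Finset.sum_eq_zero_iff_of_nonneg fun x' _ => filt_nonneg hs0 hp o x').1 h x
      (Finset.mem_univ x)]
  · exact mul_div_cancel₀ _ h

theorem mass_mul_Qstar [Fintype X] [Fintype U] [Nonempty U] [Fintype Z]
    {s0 : X → ℝ} (hs0 : ∀ x, 0 ≤ s0 x) {p : X → U → X → Z → ℝ}
    (hp : ∀ x u y z, 0 ≤ p x u y z) (r : X → U → ℝ) (γ : ℝ) (k : ℕ) (o : List (U × Z)) (u : U) :
    (∑ x, filt s0 p o x) * Qstar s0 p r γ k o u =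
      (∑ x, filt s0 p o x * r x u) +
        γ * ∑ z, (∑ y, filt s0 p (o ++ [(u, z)]) y) * Vstar s0 p r γ k (o ++ [(u, z)]) := by
  have hz : ∀ z, (∑ x, filt s0 p o x) * (if reachable s0 p (o ++ [(u, z)]) then
        (∑ x, ∑ y, bel s0 p o x * p x u y z) * Vstar s0 p r γ k (o ++ [(u, z)]) else 0) =
      (∑ y, filt s0 p (o ++ [(u, z)]) y) * Vstar s0 p r γ k (o ++ [(u, z)]) := by
    intro z
    split_ifs with h
    · rw [← mul_assoc]
      congr 1
      simp only [filt_append]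
      rw [Finset.sum_comm, Finset.mul_sum]
      refine Finset.sum_congr rfl fun y _ => ?_
      rw [Finset.mul_sum]
      refine Finset.sum_congr rfl fun x _ => ?_
      rw [← mul_assoc, mass_mul_bel hs0 hp]
    · have h0 : ∑ y, filt s0 p (o ++ [(u, z)]) y = 0 :=
        le_antisymm (not_lt.1 h) (Finset.sum_nonneg fun y _ => filt_nonneg hs0 hp _ y)
      rw [h0, mul_zero, zero_mul]
  rw [Qstar, mul_add, mul_left_comm, Finset.mul_sum, Finset.mul_sum]
  simp only [hz, ← mul_assoc, mass_mul_bel hs0 hp]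

theorem sum_filt_mul_condReturn_succ [Fintype X] [Fintype Z] (s0 : X → ℝ)
    (p : X → U → X → Z → ℝ) (r : X → U → ℝ) (γ : ℝ) (π : List (U × Z) → U) (k : ℕ)
    (o : List (U × Z)) :
    ∑ x, filt s0 p o x * condReturn p r γ π (k + 1) o x =
      (∑ x, filt s0 p o x * r x (π o)) +
        γ * ∑ z, ∑ y, filt s0 p (o ++ [(π o, z)]) y *
          condReturn p r γ π k (o ++ [(π o, z)]) y := by
  simp only [condReturn, mul_add, Finset.sum_add_distrib]
  congr 1
  simp only [filt_append, Finset.mul_sum, Finset.sum_mul]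
  rw [Finset.sum_comm_cycle]
  refine Finset.sum_congr rfl fun z _ => ?_
  rw [Finset.sum_comm]
  refine Finset.sum_congr rfl fun y _ => Finset.sum_congr rfl fun x _ => ?_
  ring

theorem Qstar_le_Vstar_succ [Fintype X] [Fintype U] [Nonempty U] [Fintype Z]
    (s0 : X → ℝ) (p : X → U → X → Z → ℝ) (r : X → U → ℝ) (γ : ℝ) (k : ℕ)
    (o : List (U × Z)) (u : U) :
    Qstar s0 p r γ k o u ≤ Vstar s0 p r γ (k + 1) o :=
  Finset.le_sup' (Qstar s0 p r γ k o) (Finset.mem_univ u)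

theorem Vstar_succ_eq_Qstar [Fintype X] [Fintype U] [Nonempty U] [Fintype Z]
    {s0 : X → ℝ} {p : X → U → X → Z → ℝ} {r : X → U → ℝ} {γ : ℝ} {k : ℕ}
    {o : List (U × Z)} {u : U} (h : ∀ u', Qstar s0 p r γ k o u' ≤ Qstar s0 p r γ k o u) :
    Vstar s0 p r γ (k + 1) o = Qstar s0 p r γ k o u :=
  le_antisymm (Finset.sup'_le _ (Qstar s0 p r γ k o) fun u' _ => h u')
    (Qstar_le_Vstar_succ s0 p r γ k o u)

theorem sum_filt_mul_condReturn_le [Fintype X] [Fintype U] [Nonempty U] [Fintype Z]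
    {s0 : X → ℝ} (hs0 : ∀ x, 0 ≤ s0 x) {p : X → U → X → Z → ℝ}
    (hp : ∀ x u y z, 0 ≤ p x u y z) (r : X → U → ℝ) {γ : ℝ} (hγ0 : 0 ≤ γ)
    (π : List (U × Z) → U) (k : ℕ) (o : List (U × Z)) :
    ∑ x, filt s0 p o x * condReturn p r γ π k o x ≤
      (∑ x, filt s0 p o x) * Vstar s0 p r γ k o := by
  induction k generalizing o with
  | zero => simp [condReturn, Vstar]
  | succ k ih =>
    refine le_trans ?_ (mul_le_mul_of_nonneg_left (Qstar_le_Vstar_succ s0 p r γ k o (π o))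
      (Finset.sum_nonneg fun x _ => filt_nonneg hs0 hp o x))
    rw [sum_filt_mul_condReturn_succ, mass_mul_Qstar hs0 hp]
    gcongr
    exact ih _

theorem sum_filt_mul_condReturn_eq [Fintype X] [Fintype U] [Nonempty U] [Fintype Z]
    {s0 : X → ℝ} (hs0 : ∀ x, 0 ≤ s0 x) {p : X → U → X → Z → ℝ}
    (hp : ∀ x u y z, 0 ≤ p x u y z) (r : X → U → ℝ) (γ : ℝ) (ℓ : ℕ)
    (π : List (U × Z) → U)
    (hπ : ∀ o : List (U × Z), o.length < ℓ → reachable s0 p o →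
      ∀ u, Qstar s0 p r γ (ℓ - o.length - 1) o u ≤ Qstar s0 p r γ (ℓ - o.length - 1) o (π o))
    (k : ℕ) (o : List (U × Z)) (hk : k + o.length = ℓ) :
    ∑ x, filt s0 p o x * condReturn p r γ π k o x =
      (∑ x, filt s0 p o x) * Vstar s0 p r γ k o := by
  induction k generalizing o with
  | zero => simp [condReturn, Vstar]
  | succ k ih =>
    have hQ : (∑ x, filt s0 p o x) * Vstar s0 p r γ (k + 1) o =
        (∑ x, filt s0 p o x) * Qstar s0 p r γ k o (π o) := by
      by_cases h : reachable s0 p o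
      · have hlen : ℓ - o.length - 1 = k := by omega
        have hmax := hπ o (by omega) h
        rw [hlen] at hmax
        rw [Vstar_succ_eq_Qstar hmax]
      · have h0 : ∑ x, filt s0 p o x = 0 :=
          le_antisymm (not_lt.1 h) (Finset.sum_nonneg fun x _ => filt_nonneg hs0 hp o x)
        rw [h0, zero_mul, zero_mul]
    rw [hQ, sum_filt_mul_condReturn_succ, mass_mul_Qstar hs0 hp]
    congr 2
    refine Finset.sum_congr rfl fun z _ => ih _ ?_
    rw [List.length_append, List.length_singleton]
    omega

end Bellman

end DecPOMDP

open DecPOMDP in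
/-- Finite-horizon Bellman optimality for partially observed models: the maximum of
`J(π)` over all history-dependent policies is `V*_0(empty history)` (so the maximum
exists and equals it), and it is attained by any policy that at every reachable
history `o ∈ O_t` (`t < ℓ`) selects an action maximizing `Q*_t(o, ·)`
(here `Q*_t = Qstar … (ℓ - t - 1)` and `V*_0 = Vstar … ℓ`). -/
theorem stmt14 (X U Z : Type) [Fintype X] [Nonempty X] [Fintype U] [Nonempty U]
    [Fintype Z] [Nonempty Z]
    (s0 : X → ℝ) (hs0 : ∀ x, 0 ≤ s0 x) (hs0sum : ∑ x, s0 x = 1)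
    (p : X → U → X → Z → ℝ) (hp : ∀ x u y z, 0 ≤ p x u y z)
    (hpsum : ∀ x u, ∑ y, ∑ z, p x u y z = 1)
    (r : X → U → ℝ) (γ : ℝ) (hγ0 : 0 ≤ γ) (hγ1 : γ ≤ 1) (ℓ : ℕ) :
    IsGreatest {val : ℝ | ∃ π : List (U × Z) → U, val = Jret s0 p r γ ℓ π}
        (Vstar s0 p r γ ℓ []) ∧
      ∀ π : List (U × Z) → U,
        (∀ o : List (U × Z), o.length < ℓ → reachable s0 p o →
          ∀ u, Qstar s0 p r γ (ℓ - o.length - 1) o u ≤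
            Qstar s0 p r γ (ℓ - o.length - 1) o (π o)) →
        Jret s0 p r γ ℓ π = Vstar s0 p r γ ℓ [] := by
  have hfilt : ∀ x, filt s0 p ([] : List (U × Z)) x = s0 x := fun _ => rfl
  have attains : ∀ π : List (U × Z) → U,
      (∀ o : List (U × Z), o.length < ℓ → reachable s0 p o →
        ∀ u, Qstar s0 p r γ (ℓ - o.length - 1) o u ≤
          Qstar s0 p r γ (ℓ - o.length - 1) o (π o)) →
      Jret s0 p r γ ℓ π = Vstar s0 p r γ ℓ [] := by
    intro π hπ
    have h := sum_filt_mul_condReturn_eq hs0 hp r γ ℓ π hπ ℓ [] rfl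
    simp only [hfilt, hs0sum, one_mul] at h
    rw [Jret_eq_sum_condReturn s0 p hpsum, h]
  refine ⟨⟨?_, ?_⟩, attains⟩
  · choose π hπ using fun o : List (U × Z) =>
      Finite.exists_max (Qstar s0 p r γ (ℓ - o.length - 1) o)
    exact ⟨π, (attains π fun o _ _ => hπ o).symm⟩
  · rintro _ ⟨π, rfl⟩
    have h := sum_filt_mul_condReturn_le hs0 hp r hγ0 π ℓ []
    simp only [hfilt, hs0sum, one_mul] at h
    rwa [Jret_eq_sum_condReturn s0 p hpsum]
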